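/- arXiv:2106.09680 — 2 statements merged into one kernel-verified Lean document; each statement's English description precedes it below -/
import Mathlib

section
/- Let k be a positive integer, μ : {1,…,k} → ℝ with M := √(Σ_{i=1}^k μ_i²) > 0, and let Φ denote the standard normal CDF. Let P = ⊗_{i=1}^k N(μ_i, 1) and Q = ⊗_{i=1}^k N(0, 1) be product Gaussian probability measures on ℝ^k. Then for every ε ≥ 0 and every Borel measurable set S ⊆ ℝ^k, P(S) − e^ε · Q(S) ≤ Φ(−ε/M + M/2) − e^ε · Φ(−ε/M − M/2). -/
open MeasureTheory ProbabilityTheory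

/-- The standard normal cumulative distribution function Φ. -/
noncomputable def stdNormalCDF (x : ℝ) : ℝ :=
  ((gaussianReal 0 1) (Set.Iic x)).toReal

open scoped ENNReal

lemma MeasureTheory.Measure.pi_withDensity {ι : Type*} [Fintype ι] {E : ι → Type*}
    {mE : ∀ i, MeasurableSpace (E i)} (ν : ∀ i, Measure (E i)) [∀ i, IsProbabilityMeasure (ν i)]
    {f : ∀ i, E i → ℝ≥0∞} (hf : ∀ i, Measurable (f i))
    [∀ i, SigmaFinite ((ν i).withDensity (f i))] :
    Measure.pi (fun i => (ν i).withDensity (f i)) =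
      (Measure.pi ν).withDensity fun x => ∏ i, f i (x i) := by
  refine Measure.pi_eq fun s hs => ?_
  have hg : ∀ i, Measurable ((s i).indicator (f i)) := fun i => (hf i).indicator (hs i)
  have h_ind : ∀ x : ∀ i, E i, (Set.univ.pi s).indicator (fun x => ∏ i, f i (x i)) x
      = ∏ i, (s i).indicator (f i) (x i) := by
    intro x
    by_cases hx : x ∈ Set.univ.pi s
    · rw [Set.indicator_of_mem hx]
      exact Finset.prod_congr rfl fun i _ => (Set.indicator_of_mem (hx i trivial) _).symm
    · rw [Set.indicator_of_notMem hx]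
      simp only [Set.mem_pi, Set.mem_univ, true_imp_iff, not_forall] at hx
      obtain ⟨i, hi⟩ := hx
      exact (Finset.prod_eq_zero (Finset.mem_univ i) (Set.indicator_of_notMem hi _)).symm
  rw [withDensity_apply _ (MeasurableSet.univ_pi hs),
    ← lintegral_indicator (MeasurableSet.univ_pi hs)]
  simp_rw [h_ind]
  rw [lintegral_prod_eq_prod_lintegral_of_indepFun (μ := Measure.pi ν) Finset.univ
    (fun i x => (s i).indicator (f i) (x i)) (iIndepFun_pi fun i => (hg i).aemeasurable)
    fun i => (hg i).comp (measurable_pi_apply i)]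
  refine Finset.prod_congr rfl fun i _ => ?_
  rw [withDensity_apply _ (hs i), ← lintegral_indicator (hs i),
    (measurePreserving_eval ν i).lintegral_comp (hg i)]

lemma ProbabilityTheory.gaussianReal_one_eq_withDensity (m : ℝ) :
    gaussianReal m 1 =
      (gaussianReal 0 1).withDensity fun x => ENNReal.ofReal (Real.exp (m * x - m ^ 2 / 2)) := by
  rw [gaussianReal_of_var_ne_zero _ one_ne_zero, gaussianReal_of_var_ne_zero _ one_ne_zero,
    ← withDensity_mul _ (measurable_gaussianPDF 0 1) (by fun_prop)]
  congr 1
  ext x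
  rw [Pi.mul_apply, gaussianPDF, gaussianPDF,
    ← ENNReal.ofReal_mul (gaussianPDFReal_nonneg 0 1 x), gaussianPDFReal, gaussianPDFReal,
    mul_assoc, mul_assoc, ← Real.exp_add]
  congr 3
  push_cast
  ring

lemma ProbabilityTheory.pi_gaussianReal_eq_withDensity {ι : Type*} [Fintype ι] (m : ι → ℝ) :
    Measure.pi (fun i => gaussianReal (m i) 1) =
      (Measure.pi fun _ : ι => gaussianReal 0 1).withDensity fun x =>
        ENNReal.ofReal (Real.exp (∑ i, m i * x i - (∑ i, m i ^ 2) / 2)) := by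
  have h (i : ι) : SigmaFinite ((gaussianReal 0 1).withDensity
      fun x => ENNReal.ofReal (Real.exp (m i * x - m i ^ 2 / 2))) := by
    rw [← gaussianReal_one_eq_withDensity]
    infer_instance
  simp_rw [gaussianReal_one_eq_withDensity (m _)]
  rw [Measure.pi_withDensity _ fun i => by fun_prop]
  congr 1
  ext x
  rw [← ENNReal.ofReal_prod_of_nonneg fun i _ => (Real.exp_pos _).le, ← Real.exp_sum,
    Finset.sum_sub_distrib, Finset.sum_div]

lemma ProbabilityTheory.map_sum_mul_pi_gaussianReal {ι : Type*} [Fintype ι]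
    (c m : ι → ℝ) {s : ℝ} (hs : s ^ 2 = ∑ i, c i ^ 2) :
    (Measure.pi fun i => gaussianReal (m i) 1).map (fun x => ∑ i, c i * x i) =
      (gaussianReal 0 1).map fun x => ∑ i, c i * m i - s * x := by
  have h_law : (gaussianReal 0 1).map (fun x => ∑ i, c i * m i - s * x) =
      gaussianReal (∑ i, c i * m i) (.mk (s ^ 2) (sq_nonneg s)) := by
    rw [show (fun x => ∑ i, c i * m i - s * x) =
      (fun y => ∑ i, c i * m i - y) ∘ fun x => s * x from rfl,
      ← Measure.map_map (by fun_prop) (by fun_prop), gaussianReal_map_const_mul,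
      gaussianReal_map_const_sub]
    simp
  rw [h_law]
  refine Measure.ext_of_charFun ?_
  ext t
  rw [(iIndepFun_pi (μ := fun i => gaussianReal (m i) 1) (X := fun i x => c i * x)
    fun i => by fun_prop).charFun_map_fun_sum_eq_prod
      fun i => ((measurable_pi_apply i).const_mul (c i)).aemeasurable, Finset.prod_apply]
  have h_map (i : ι) : (Measure.pi fun i => gaussianReal (m i) 1).map (fun x => c i * x i) =
      gaussianReal (c i * m i) (.mk (c i ^ 2) (sq_nonneg _)) := by
    rw [show (fun x : ι → ℝ => c i * x i) = (fun y => c i * y) ∘ Function.eval i from rfl,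
      ← Measure.map_map (by fun_prop) (by fun_prop), (measurePreserving_eval _ i).map_eq,
      gaussianReal_map_const_mul, mul_one]
  simp_rw [h_map, charFun_gaussianReal, ← Complex.exp_sum]
  congr 1
  have hs' : ((s : ℂ)) ^ 2 = ∑ i, (c i : ℂ) ^ 2 := by exact_mod_cast hs
  simp only [NNReal.coe_mk, Complex.ofReal_pow, Complex.ofReal_sum, Finset.sum_sub_distrib, hs',
    Finset.sum_mul, Finset.mul_sum, Finset.sum_div]

lemma pi_gaussianReal_halfspace {ι : Type*} [Fintype ι] (c m : ι → ℝ) {s : ℝ} (hs_pos : 0 < s)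
    (hs : s ^ 2 = ∑ i, c i ^ 2) (a : ℝ) :
    (Measure.pi fun i => gaussianReal (m i) 1).real {x | a ≤ ∑ i, c i * x i} =
      stdNormalCDF ((∑ i, c i * m i - a) / s) := by
  rw [show {x : ι → ℝ | a ≤ ∑ i, c i * x i} = (fun x => ∑ i, c i * x i) ⁻¹' Set.Ici a from rfl,
    ← map_measureReal_apply (by fun_prop) measurableSet_Ici, map_sum_mul_pi_gaussianReal c m hs,
    map_measureReal_apply (by fun_prop) measurableSet_Ici, stdNormalCDF, measureReal_def]
  congr 2
  ext x
  simp only [Set.mem_preimage, Set.mem_Ici, Set.mem_Iic, le_div_iff₀ hs_pos]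
  constructor <;> intro h <;> linarith

/-- The Neyman–Pearson lemma, in its Lagrangian form. -/
lemma measureReal_withDensity_sub_le {α : Type*} [MeasurableSpace α] (ν : Measure α)
    [IsFiniteMeasure ν] {f : α → ℝ≥0∞} [IsFiniteMeasure (ν.withDensity f)] {t : ℝ} (ht : 0 ≤ t)
    {A S : Set α} (hA : MeasurableSet A) (hS : MeasurableSet S)
    (h_le : ∀ x ∈ A, ENNReal.ofReal t ≤ f x) (h_ge : ∀ x ∉ A, f x ≤ ENNReal.ofReal t) :
    (ν.withDensity f).real S - t * ν.real S ≤ (ν.withDensity f).real A - t * ν.real A := by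
  have h₁ : (ν.withDensity f).real (S \ A) ≤ t * ν.real (S \ A) := by
    rw [measureReal_def, measureReal_def, ← ENNReal.toReal_ofReal_mul _ _ ht]
    refine ENNReal.toReal_mono (by finiteness) ?_
    rw [withDensity_apply _ (hS.diff hA), ← setLIntegral_const]
    exact setLIntegral_mono measurable_const fun x hx => h_ge x hx.2
  have h₂ : t * ν.real (A \ S) ≤ (ν.withDensity f).real (A \ S) := by
    rw [measureReal_def, measureReal_def, ← ENNReal.toReal_ofReal_mul _ _ ht]
    refine ENNReal.toReal_mono (measure_ne_top _ _) ?_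
    rw [withDensity_apply _ (hA.diff hS), ← setLIntegral_const]
    exact setLIntegral_mono' (hA.diff hS) fun x hx => h_le x hx.1
  have e₁ := measureReal_inter_add_sdiff (μ := ν.withDensity f) hA (s := S)
  have e₂ := measureReal_inter_add_sdiff (μ := ν) hA (s := S)
  have e₃ := measureReal_inter_add_sdiff (μ := ν.withDensity f) hS (s := A)
  have e₄ := measureReal_inter_add_sdiff (μ := ν) hS (s := A)
  rw [Set.inter_comm A S] at e₃ e₄
  rw [← e₁, ← e₂, ← e₃, ← e₄]
  linarith

/-- GDP composition/tensorization in hockey-stick form: for product Gaussian measures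
P = ⊗ N(μᵢ,1) and Q = ⊗ N(0,1) on ℝ^k with M = √(Σ μᵢ²) > 0, for every ε ≥ 0 and every
Borel set S ⊆ ℝ^k, P(S) − e^ε Q(S) ≤ Φ(−ε/M + M/2) − e^ε Φ(−ε/M − M/2). -/
theorem product_gaussian_hockey_stick (k : ℕ) (hk : 0 < k) (μ : Fin k → ℝ)
    (M : ℝ) (hM : M = Real.sqrt (∑ i, (μ i) ^ 2)) (hMpos : 0 < M) :
    ∀ ε : ℝ, 0 ≤ ε → ∀ S : Set (Fin k → ℝ), MeasurableSet S →
      ((Measure.pi fun i => gaussianReal (μ i) 1) S).toReal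
          - Real.exp ε * ((Measure.pi fun _ => gaussianReal 0 1) S).toReal
        ≤ stdNormalCDF (-(ε / M) + M / 2) - Real.exp ε * stdNormalCDF (-(ε / M) - M / 2) := by
  intro ε _ S hS
  have hM_sq : M ^ 2 = ∑ i, μ i ^ 2 := by
    rw [hM, Real.sq_sqrt (Finset.sum_nonneg fun i _ => sq_nonneg _)]
  have h_dens := pi_gaussianReal_eq_withDensity μ
  rw [← hM_sq] at h_dens
  have : IsFiniteMeasure ((Measure.pi fun _ : Fin k => gaussianReal 0 1).withDensity fun x =>
      ENNReal.ofReal (Real.exp (∑ i, μ i * x i - M ^ 2 / 2))) := by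
    rw [← h_dens]
    infer_instance
  have h_np := measureReal_withDensity_sub_le (Measure.pi fun _ : Fin k => gaussianReal 0 1)
    (f := fun x => ENNReal.ofReal (Real.exp (∑ i, μ i * x i - M ^ 2 / 2))) (Real.exp_pos ε).le
    (A := {x | ε + M ^ 2 / 2 ≤ ∑ i, μ i * x i}) (measurableSet_le (by fun_prop) (by fun_prop)) hS
    (fun x hx => ENNReal.ofReal_le_ofReal (Real.exp_le_exp.2 (by
      rw [Set.mem_ofPred_eq] at hx; linarith)))
    (fun x hx => ENNReal.ofReal_le_ofReal (Real.exp_le_exp.2 (by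
      rw [Set.mem_ofPred_eq, not_le] at hx; linarith)))
  rw [← h_dens, pi_gaussianReal_halfspace μ μ hMpos hM_sq,
    pi_gaussianReal_halfspace μ (fun _ => 0) hMpos hM_sq] at h_np
  have h_mean : ∑ i, μ i * μ i = M ^ 2 := by simp_rw [hM_sq, sq]
  have h₁ : (∑ i, μ i * μ i - (ε + M ^ 2 / 2)) / M = -(ε / M) + M / 2 := by
    rw [h_mean]
    field_simp
    ring
  have h₂ : (∑ i, μ i * 0 - (ε + M ^ 2 / 2)) / M = -(ε / M) - M / 2 := by
    simp only [mul_zero, Finset.sum_const_zero]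
    field_simp
    ring
  rwa [h₁, h₂] at h_np
end

section
/- Let E and K be positive integers, n = E·K, let R > 0, σ > 0, and set M = √n / σ. Let a, b : {1,…,n} → ℝ satisfy |a_i − b_i| ≤ R for all i, and let P = ⊗_{i=1}^n N(a_i, σ²R²) and Q = ⊗_{i=1}^n N(b_i, σ²R²) be product Gaussian measures on ℝ^n. Then for every ε ≥ 0 and every Borel measurable set S ⊆ ℝ^n, P(S) ≤ e^ε · Q(S) + [Φ(−ε/M + M/2) − e^ε · Φ(−ε/M − M/2)], where Φ is the standard normal CDF. -/
open MeasureTheory ProbabilityTheory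

/-- The exponential tilt taking `N(b, v)` to `N(a, v)`. -/
theorem gaussianReal_eq_withDensity (a b : ℝ) {v : NNReal} (hv : v ≠ 0) :
    gaussianReal a v = (gaussianReal b v).withDensity
      (fun x => ENNReal.ofReal (Real.exp (((a - b) * x - (a ^ 2 - b ^ 2) / 2) / v))) := by
  rw [gaussianReal_of_var_ne_zero _ hv, gaussianReal_of_var_ne_zero _ hv,
    ← withDensity_mul _ (measurable_gaussianPDF b v) (by fun_prop)]
  congr 1
  ext x
  have hv' : (v : ℝ) ≠ 0 := by exact_mod_cast hv
  rw [Pi.mul_apply, gaussianPDF, gaussianPDF,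
    ← ENNReal.ofReal_mul (gaussianPDFReal_nonneg b v x), gaussianPDFReal, gaussianPDFReal,
    mul_assoc _ (Real.exp _), ← Real.exp_add]
  congr 3
  field_simp
  ring

theorem pi_eq_withDensity_prod {ι : Type*} [Fintype ι] (μ ν : ι → Measure ℝ)
    [∀ i, SigmaFinite (μ i)] [∀ i, SigmaFinite (ν i)] (f : ι → ℝ → ℝ)
    (hf : ∀ i x, 0 ≤ f i x) (hfi : ∀ i, Integrable (f i) (ν i))
    (hμ : ∀ i, μ i = (ν i).withDensity fun x => ENNReal.ofReal (f i x)) :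
    Measure.pi μ = (Measure.pi ν).withDensity fun x => ENNReal.ofReal (∏ i, f i (x i)) := by
  refine Measure.pi_eq fun s hs => ?_
  have hg : ∀ i, Integrable ((s i).indicator (f i)) (ν i) := fun i => (hfi i).indicator (hs i)
  have hg0 : ∀ i x, 0 ≤ (s i).indicator (f i) x := fun i => Set.indicator_nonneg fun x _ => hf i x
  have hind : (Set.univ.pi s).indicator (fun x => ENNReal.ofReal (∏ i, f i (x i))) =
      fun x => ENNReal.ofReal (∏ i, (s i).indicator (f i) (x i)) := by
    ext x
    by_cases hx : x ∈ Set.univ.pi s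
    · rw [Set.indicator_of_mem hx]
      congr 1
      exact Finset.prod_congr rfl fun i _ => (Set.indicator_of_mem (hx i trivial) _).symm
    · rw [Set.indicator_of_notMem hx]
      obtain ⟨i, hi⟩ : ∃ i, x i ∉ s i := by simpa [Set.mem_pi] using hx
      rw [Finset.prod_eq_zero (Finset.mem_univ i) (Set.indicator_of_notMem hi _),
        ENNReal.ofReal_zero]
  rw [withDensity_apply _ (MeasurableSet.univ_pi hs),
    ← lintegral_indicator (MeasurableSet.univ_pi hs), hind,
    ← ofReal_integral_eq_lintegral_ofReal (Integrable.fintype_prod hg)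
      (ae_of_all _ fun x => Finset.prod_nonneg fun i _ => hg0 i (x i)),
    integral_fintype_prod_eq_prod,
    ENNReal.ofReal_prod_of_nonneg fun i _ => integral_nonneg (hg0 i)]
  refine Finset.prod_congr rfl fun i _ => ?_
  rw [ofReal_integral_eq_lintegral_ofReal (hg i) (ae_of_all _ (hg0 i)), hμ i,
    withDensity_apply _ (hs i), ← lintegral_indicator (hs i)]
  congr 1 with x
  by_cases hx : x ∈ s i <;> simp [hx]

theorem pi_gaussianReal_map_sum_mul {ι : Type*} [Fintype ι] (m c : ι → ℝ) (v : NNReal) :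
    (Measure.pi fun i => gaussianReal (m i) v).map (fun x => ∑ i, c i * x i) =
      gaussianReal (∑ i, c i * m i) (Real.toNNReal (v * ∑ i, c i ^ 2)) := by
  have hmeas : Measurable fun x : ι → ℝ => ∑ i, c i * x i := by fun_prop
  have : IsProbabilityMeasure
      ((Measure.pi fun i => gaussianReal (m i) v).map (fun x => ∑ i, c i * x i)) :=
    Measure.isProbabilityMeasure_map hmeas.aemeasurable
  refine Measure.ext_of_charFun ?_
  ext t
  rw [charFun_apply_real, integral_map hmeas.aemeasurable (by fun_prop)]
  have hprod : ∀ x : ι → ℝ, Complex.exp (t * ((∑ i, c i * x i : ℝ) : ℂ) * Complex.I) =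
      ∏ i, Complex.exp (((t * c i : ℝ) : ℂ) * x i * Complex.I) := by
    intro x
    rw [← Complex.exp_sum]
    push_cast
    simp_rw [Finset.mul_sum, Finset.sum_mul, mul_assoc]
  simp_rw [hprod]
  rw [integral_fintype_prod_eq_prod
    (f := fun i (x : ℝ) => Complex.exp (((t * c i : ℝ) : ℂ) * x * Complex.I))]
  simp_rw [← charFun_apply_real, charFun_gaussianReal, ← Complex.exp_sum]
  rw [Real.coe_toNNReal _ (by positivity)]
  push_cast
  simp_rw [Finset.sum_sub_distrib, Finset.mul_sum, Finset.sum_mul, Finset.sum_div]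
  congr 2 <;> exact Finset.sum_congr rfl fun i _ => by ring

/-- Upper tails of a Gaussian in terms of the standard normal distribution function. -/
theorem gaussianReal_real_Ici (m t : ℝ) {s : ℝ} (hs : 0 < s) :
    (gaussianReal m (Real.toNNReal (s ^ 2))).real (Set.Ici t) = stdNormalCDF ((m - t) / s) := by
  have hmap : (gaussianReal 0 1).map (fun x => m - s * x) =
      gaussianReal m (Real.toNNReal (s ^ 2)) := by
    have h : (fun x : ℝ => m - s * x) = (fun x => m - x) ∘ (fun x => s * x) := rfl
    rw [h, ← Measure.map_map (by fun_prop) (by fun_prop), gaussianReal_map_const_mul,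
      gaussianReal_map_const_sub]
    congr 1
    · simp
    · ext
      simp [sq_nonneg]
  rw [← hmap, measureReal_def, Measure.map_apply (by fun_prop) measurableSet_Ici, stdNormalCDF]
  congr 2
  ext x
  simp only [Set.mem_preimage, Set.mem_Ici, Set.mem_Iic]
  rw [le_div_iff₀ hs]
  constructor <;> intro h <;> linarith

/-- The Neyman–Pearson inequality: the likelihood-ratio test maximises `P S - κ * Q S`. -/
theorem measureReal_sub_le_of_withDensity {Ω : Type*} [MeasurableSpace Ω] (P Q : Measure Ω)
    [IsFiniteMeasure P] [IsFiniteMeasure Q] {f : Ω → ℝ} (hf : Measurable f) (hf0 : ∀ x, 0 ≤ f x)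
    (hP : P = Q.withDensity fun x => ENNReal.ofReal (f x)) (κ : ℝ) {S : Set Ω}
    (hS : MeasurableSet S) :
    P.real S - κ * Q.real S ≤ P.real {x | κ ≤ f x} - κ * Q.real {x | κ ≤ f x} := by
  have hfi : Integrable f Q := by
    refine ⟨hf.aestronglyMeasurable, ?_⟩
    rw [hasFiniteIntegral_iff_ofReal (ae_of_all _ hf0)]
    have := measure_lt_top P Set.univ
    rwa [hP, withDensity_apply _ MeasurableSet.univ, setLIntegral_univ] at this
  have key : ∀ T, MeasurableSet T → P.real T - κ * Q.real T = ∫ x in T, (f x - κ) ∂Q := by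
    intro T hT
    rw [integral_sub hfi.integrableOn (integrable_const κ).integrableOn, setIntegral_const,
      smul_eq_mul, mul_comm κ, measureReal_def P, hP, withDensity_apply _ hT,
      ← ofReal_integral_eq_lintegral_ofReal hfi.integrableOn (ae_of_all _ hf0),
      ENNReal.toReal_ofReal (integral_nonneg hf0)]
  rw [key S hS, key _ (measurableSet_le measurable_const hf)]
  simpa only [Pi.sub_apply, sub_nonneg] using setIntegral_le_nonneg hS
    (hf.sub measurable_const).stronglyMeasurable (hfi.sub (integrable_const κ))

/-- The `(ε, δ)` trade-off between two product Gaussians whose means are at distance exactly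
`M * s`, where `s` is the common standard deviation. -/
theorem pi_gaussianReal_real_le_of_sum_sq_eq {ι : Type*} [Fintype ι] (a b : ι → ℝ) {s M : ℝ}
    (hs : 0 < s) (hM : 0 < M) (hab : ∑ i, (a i - b i) ^ 2 = (M * s) ^ 2) (ε : ℝ)
    {S : Set (ι → ℝ)} (hS : MeasurableSet S) :
    (Measure.pi fun i => gaussianReal (a i) (Real.toNNReal (s ^ 2))).real S ≤
      Real.exp ε * (Measure.pi fun i => gaussianReal (b i) (Real.toNNReal (s ^ 2))).real S +
        (stdNormalCDF (-(ε / M) + M / 2) - Real.exp ε * stdNormalCDF (-(ε / M) - M / 2)) := by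
  set v := Real.toNNReal (s ^ 2) with hv
  have hvs : (v : ℝ) = s ^ 2 := Real.coe_toNNReal _ (sq_nonneg s)
  have hv0 : v ≠ 0 := by
    rw [hv, Ne, Real.toNNReal_eq_zero, not_le]
    positivity
  set f : ι → ℝ → ℝ := fun i x =>
    Real.exp (((a i - b i) * x - (a i ^ 2 - b i ^ 2) / 2) / v) with hf
  have htilt : ∀ i, gaussianReal (a i) v =
      (gaussianReal (b i) v).withDensity fun x => ENNReal.ofReal (f i x) :=
    fun i => gaussianReal_eq_withDensity (a i) (b i) hv0
  have hfi : ∀ i, Integrable (f i) (gaussianReal (b i) v) := by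
    intro i
    have h := (integrable_exp_mul_gaussianReal (μ := b i) (v := v) ((a i - b i) / v)).mul_const
      (Real.exp (-((a i ^ 2 - b i ^ 2) / 2 / v)))
    refine h.congr (ae_of_all _ fun x => ?_)
    simp only [hf, ← Real.exp_add]
    congr 1
    ring
  have hNP := measureReal_sub_le_of_withDensity _ _ (f := fun x : ι → ℝ => ∏ i, f i (x i))
    (by fun_prop) (fun x => Finset.prod_nonneg fun i _ => (Real.exp_pos _).le)
    (pi_eq_withDensity_prod (fun i => gaussianReal (a i) v) (fun i => gaussianReal (b i) v) f
      (fun i x => (Real.exp_pos _).le) hfi htilt) (Real.exp ε) hS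
  have hT : {x : ι → ℝ | Real.exp ε ≤ ∏ i, f i (x i)} =
      (fun x => ∑ i, (a i - b i) * x i) ⁻¹'
        Set.Ici (s ^ 2 * ε + ∑ i, (a i ^ 2 - b i ^ 2) / 2) := by
    ext x
    simp only [hf, Set.mem_ofPred_eq, Set.mem_preimage, Set.mem_Ici]
    rw [← Real.exp_sum, Real.exp_le_exp, ← Finset.sum_div, Finset.sum_sub_distrib, hvs,
      le_div_iff₀ (by positivity), le_sub_iff_add_le, mul_comm ε]
  have htail : ∀ m : ι → ℝ, (Measure.pi fun i => gaussianReal (m i) v).real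
      {x : ι → ℝ | Real.exp ε ≤ ∏ i, f i (x i)} =
      stdNormalCDF ((∑ i, (a i - b i) * m i - (s ^ 2 * ε + ∑ i, (a i ^ 2 - b i ^ 2) / 2)) /
        (M * s ^ 2)) := by
    intro m
    rw [hT, ← map_measureReal_apply (by fun_prop) measurableSet_Ici,
      pi_gaussianReal_map_sum_mul m (fun i => a i - b i) v, hab, hvs,
      show s ^ 2 * (M * s) ^ 2 = (M * s ^ 2) ^ 2 by ring,
      gaussianReal_real_Ici _ _ (by positivity)]
  have hA : ∑ i, (a i - b i) * a i = (M * s) ^ 2 / 2 + ∑ i, (a i ^ 2 - b i ^ 2) / 2 := by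
    rw [← hab, Finset.sum_div, ← Finset.sum_add_distrib]
    exact Finset.sum_congr rfl fun i _ => by ring
  have hB : ∑ i, (a i - b i) * b i = -((M * s) ^ 2 / 2) + ∑ i, (a i ^ 2 - b i ^ 2) / 2 := by
    rw [← hab, Finset.sum_div, ← Finset.sum_neg_distrib, ← Finset.sum_add_distrib]
    exact Finset.sum_congr rfl fun i _ => by ring
  rw [htail a, htail b, hA, hB] at hNP
  have e₁ : ((M * s) ^ 2 / 2 + ∑ i, (a i ^ 2 - b i ^ 2) / 2 -
      (s ^ 2 * ε + ∑ i, (a i ^ 2 - b i ^ 2) / 2)) / (M * s ^ 2) = -(ε / M) + M / 2 := by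
    field_simp
    ring
  have e₂ : (-((M * s) ^ 2 / 2) + ∑ i, (a i ^ 2 - b i ^ 2) / 2 -
      (s ^ 2 * ε + ∑ i, (a i ^ 2 - b i ^ 2) / 2)) / (M * s ^ 2) = -(ε / M) - M / 2 := by
    field_simp
    ring
  rw [e₁, e₂] at hNP
  linarith

theorem pi_map_fin_tail {n : ℕ} (μ : Fin (n + 1) → Measure ℝ) [∀ i, IsProbabilityMeasure (μ i)] :
    (Measure.pi μ).map Fin.tail = Measure.pi fun i => μ i.succ := by
  simpa only [Fin.zero_succAbove] using!
    (measurePreserving_snd.comp (measurePreserving_piFinSuccAbove μ 0)).map_eq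

/-- The trade-off is monotone in the distance between the means: an extra coordinate
pads the distance to exactly `M * s`. -/
theorem pi_gaussianReal_real_le_of_sum_sq_le {n : ℕ} (a b : Fin n → ℝ) {s M : ℝ}
    (hs : 0 < s) (hM : 0 < M) (hab : ∑ i, (a i - b i) ^ 2 ≤ (M * s) ^ 2) (ε : ℝ)
    {S : Set (Fin n → ℝ)} (hS : MeasurableSet S) :
    (Measure.pi fun i => gaussianReal (a i) (Real.toNNReal (s ^ 2))).real S ≤
      Real.exp ε * (Measure.pi fun i => gaussianReal (b i) (Real.toNNReal (s ^ 2))).real S +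
        (stdNormalCDF (-(ε / M) + M / 2) - Real.exp ε * stdNormalCDF (-(ε / M) - M / 2)) := by
  have hmeas : Measurable (Fin.tail : (Fin (n + 1) → ℝ) → Fin n → ℝ) :=
    measurable_pi_lambda _ fun i => measurable_pi_apply i.succ
  have hpad : ∀ (m : Fin n → ℝ) (c : ℝ),
      (Measure.pi fun i => gaussianReal (m i) (Real.toNNReal (s ^ 2))).real S =
      (Measure.pi fun i => gaussianReal ((Fin.cons c m : Fin (n + 1) → ℝ) i)
        (Real.toNNReal (s ^ 2))).real (Fin.tail ⁻¹' S) := by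
    intro m c
    rw [← map_measureReal_apply hmeas hS, pi_map_fin_tail]
    simp only [Fin.cons_succ]
  rw [hpad a √((M * s) ^ 2 - ∑ i, (a i - b i) ^ 2), hpad b 0]
  refine pi_gaussianReal_real_le_of_sum_sq_eq _ _ hs hM ?_ ε (hmeas hS)
  rw [Fin.sum_univ_succ]
  simp only [Fin.cons_zero, Fin.cons_succ, sub_zero]
  rw [Real.sq_sqrt (sub_nonneg.mpr hab)]
  ring

/-- DP-EBM privacy guarantee: releasing n = E·K noisy sums, each of sensitivity R with
Gaussian noise of standard deviation σR, is (√(E·K)/σ)-GDP; converted to (ε,δ)-DP, for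
neighboring datasets with per-iteration statistics a, b satisfying |aᵢ − bᵢ| ≤ R, the
joint output distributions P = ⊗ N(aᵢ, σ²R²) and Q = ⊗ N(bᵢ, σ²R²) satisfy
P(S) ≤ e^ε Q(S) + Φ(−ε/M + M/2) − e^ε Φ(−ε/M − M/2) with M = √n/σ. -/
theorem dp_ebm_privacy (E K : ℕ) (hE : 0 < E) (hK : 0 < K) (R σ : ℝ)
    (hR : 0 < R) (hσ : 0 < σ) (M : ℝ) (hM : M = Real.sqrt (E * K) / σ)
    (a b : Fin (E * K) → ℝ) (hab : ∀ i, |a i - b i| ≤ R) :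
    ∀ ε : ℝ, 0 ≤ ε → ∀ S : Set (Fin (E * K) → ℝ), MeasurableSet S →
      ((Measure.pi fun i => gaussianReal (a i) (Real.toNNReal (σ ^ 2 * R ^ 2))) S).toReal
        ≤ Real.exp ε
              * ((Measure.pi fun i => gaussianReal (b i) (Real.toNNReal (σ ^ 2 * R ^ 2))) S).toReal
            + (stdNormalCDF (-(ε / M) + M / 2) - Real.exp ε * stdNormalCDF (-(ε / M) - M / 2)) := by
  intro ε _ S hS
  have hn : (0 : ℝ) < E * K := by positivity
  rw [← mul_pow]
  refine pi_gaussianReal_real_le_of_sum_sq_le a b (mul_pos hσ hR) (hM ▸ by positivity) ?_ ε hS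
  calc ∑ i, (a i - b i) ^ 2 ≤ ∑ _i : Fin (E * K), R ^ 2 :=
        Finset.sum_le_sum fun i _ => sq_le_sq' (neg_le_of_abs_le (hab i)) (le_of_abs_le (hab i))
    _ = (M * (σ * R)) ^ 2 := by
        rw [hM, ← mul_assoc, div_mul_cancel₀ _ hσ.ne', mul_pow, Real.sq_sqrt hn.le]
        simp
end
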